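/- Let k be an arbitrary field, P = k[x,y,z,w] the polynomial ring in four variables over k, and Φ : P → k a k-linear functional that vanishes on every monomial of total degree different from 3. Suppose the ideal ann Φ = {f ∈ P : Φ(f·g) = 0 for all g ∈ P} contains no nonzero linear form. Then the minimal number of generators of the ideal ann Φ (the least cardinality of a generating set of ann Φ as an ideal, e.g. Submodule.spanRank) is equal to 6, 7, or 9. -/

import Mathlib

open MvPolynomial

noncomputable section

/-- The least cardinality of a set generating the submodule `p`
(the minimal number of generators of `p`). -/
def Submodule.spanRankCard {R M : Type*} [Semiring R] [AddCommMonoid M] [Module R M]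
    (p : Submodule R M) : Cardinal :=
  ⨅ s : {s : Set M // Submodule.span R s = p}, Cardinal.mk s.1

variable (k : Type*) [Field k]

/-- The annihilator ideal `ann Φ = {f : Φ(f·g) = 0 for all g}` of the
linear functional `Φ`. -/
def annIdeal (Φ : MvPolynomial (Fin 4) k →ₗ[k] k) : Ideal (MvPolynomial (Fin 4) k) where
  carrier := {f | ∀ g, Φ (f * g) = 0}
  add_mem' := by
    intro a b ha hb g
    rw [add_mul, map_add, ha g, hb g, add_zero]
  zero_mem' := by intro g; simp
  smul_mem' := by
    intro c a ha g
    have h : c • a * g = a * (c * g) := by rw [smul_eq_mul]; ring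
    rw [h]; exact ha (c * g)

namespace CubicCentre
open Module

variable {K V : Type*} [Field K] [AddCommGroup V] [Module K V]

/-- The centre of a trilinear form. -/
def cen (F : V →ₗ[K] V →ₗ[K] V →ₗ[K] K) : Submodule K (End K V) where
  carrier := {M | ∀ a b c, F (M a) b c = F a (M b) c}
  add_mem' := by
    intro M N hM hN a b c
    simp [hM a b c, hN a b c]
  zero_mem' := by intro a b c; simp
  smul_mem' := by
    intro r M hM a b c
    simp [hM a b c]

theorem mem_cen {F : V →ₗ[K] V →ₗ[K] V →ₗ[K] K} {M : End K V} :
    M ∈ cen F ↔ ∀ a b c, F (M a) b c = F a (M b) c := Iff.rfl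

/-- A nondegenerate symmetric trilinear form. -/
structure Good (F : V →ₗ[K] V →ₗ[K] V →ₗ[K] K) : Prop where
  s1 : ∀ a b c, F a b c = F b a c
  s2 : ∀ a b c, F a b c = F a c b
  nd : ∀ a, (∀ b c, F a b c = 0) → a = 0

variable {F : V →ₗ[K] V →ₗ[K] V →ₗ[K] K}

theorem one_mem_cen : (1 : End K V) ∈ cen F := by intro a b c; simp

theorem b3 (hF : Good F) {M : End K V} (hM : M ∈ cen F) (a b c : V) :
    F (M a) b c = F a b (M c) := by
  rw [hF.s2, hM, hF.s2]

theorem b2 {M : End K V} (hM : M ∈ cen F) (a b c : V) :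
    F (M a) b c = F a (M b) c := hM a b c

theorem b23 (hF : Good F) {M : End K V} (hM : M ∈ cen F) (a b c : V) :
    F a (M b) c = F a b (M c) := by
  rw [← b2 hM, b3 hF hM]

theorem comm_cen (hF : Good F) {M N : End K V} (hM : M ∈ cen F) (hN : N ∈ cen F) (x : V) :
    M (N x) = N (M x) := by
  rw [← sub_eq_zero]
  apply hF.nd
  intro b c
  rw [map_sub, LinearMap.sub_apply, LinearMap.sub_apply, sub_eq_zero]
  rw [b2 hM, b3 hF hN, b3 hF hN, b2 hM]

theorem mul_mem_cen (hF : Good F) {M N : End K V} (hM : M ∈ cen F) (hN : N ∈ cen F) :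
    M * N ∈ cen F := by
  intro a b c
  rw [Module.End.mul_apply, Module.End.mul_apply, b2 hM, b2 hN, comm_cen hF hM hN]

/-- The orbit of a vector. -/
def orb (F : V →ₗ[K] V →ₗ[K] V →ₗ[K] K) (u : V) : Submodule K V :=
  (cen F).map (LinearMap.applyₗ u)

theorem mem_orb {u x : V} : x ∈ orb F u ↔ ∃ z ∈ cen F, z u = x := by
  simp [orb, Submodule.mem_map]

theorem self_mem_orb (u : V) : u ∈ orb F u := mem_orb.2 ⟨1, one_mem_cen, rfl⟩

theorem apply_mem_orb {u : V} {z : End K V} (hz : z ∈ cen F) : z u ∈ orb F u :=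
  mem_orb.2 ⟨z, hz, rfl⟩

theorem orb_inv (hF : Good F) {u x : V} {z : End K V} (hz : z ∈ cen F) (hx : x ∈ orb F u) :
    z x ∈ orb F u := by
  obtain ⟨y, hy, rfl⟩ := mem_orb.1 hx
  exact mem_orb.2 ⟨z * y, mul_mem_cen hF hz hy, rfl⟩

variable [FiniteDimensional K V]

theorem twogen (hF : Good F) (hV : finrank K V = 4) (u v : V) (h : orb F u ⊔ orb F v = ⊤) :
    finrank K (cen F) = 4 := by
  have hx : ∀ x : V, ∃ r ∈ cen F, ∃ s ∈ cen F, r u + s v = x := by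
    intro x
    have : x ∈ orb F u ⊔ orb F v := by rw [h]; trivial
    obtain ⟨a, ha, b, hb, rfl⟩ := Submodule.mem_sup.1 this
    obtain ⟨r, hr, rfl⟩ := mem_orb.1 ha
    obtain ⟨s, hs, rfl⟩ := mem_orb.1 hb
    exact ⟨r, hr, s, hs, rfl⟩
  have hzero : ∀ x, (∀ w, F x u w = 0) → (∀ w, F x v w = 0) → x = 0 := by
    intro x h1 h2
    apply hF.nd
    intro y w
    obtain ⟨r, hr, s, hs, rfl⟩ := hx y
    rw [map_add, LinearMap.add_apply, b23 hF hr, b23 hF hs, h1, h2, add_zero]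
  let L : V × V →ₗ[K] Dual K V :=
    (F.flip v).coprod (-(F u))
  have hL : ∀ m : V × V, ∀ w, L m w = F m.1 v w - F u m.2 w := by
    intro m w
    simp [L, sub_eq_add_neg]
  have hLs : Function.Surjective L := by
    rw [← LinearMap.range_eq_top]
    by_contra hne
    obtain ⟨f, hf, hle⟩ := Submodule.exists_le_ker_of_lt_top _ (lt_top_iff_ne_top.2 hne)
    obtain ⟨w, rfl⟩ := (Module.evalEquiv K V).surjective f
    apply hf
    have key : ∀ m, L m w = 0 := fun m => by
      have := hle (LinearMap.mem_range_self L m)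
      simpa using this
    have : w = 0 := by
      apply hzero
      · intro x
        have := key (0, x)
        rw [hL] at this
        simp at this
        rw [hF.s1, hF.s2, this]
      · intro x
        have := key (x, 0)
        rw [hL] at this
        simp at this
        rw [hF.s2, hF.s1, hF.s2, this]
    simp [this]
  have hk : finrank K (LinearMap.ker L) = 4 := by
    have h1 := LinearMap.finrank_range_add_finrank_ker L
    rw [LinearMap.range_eq_top.2 hLs, finrank_top, Subspace.dual_finrank_eq,
      Module.finrank_prod, hV] at h1
    omega
  let E : cen F →ₗ[K] V × V :=
    ((LinearMap.applyₗ u).prod (LinearMap.applyₗ v)).comp (cen F).subtype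
  have hE : ∀ M : cen F, E M = (M.1 u, M.1 v) := fun M => rfl
  have hEi : Function.Injective E := by
    rw [← LinearMap.ker_eq_bot, LinearMap.ker_eq_bot']
    intro M hM
    rw [hE, Prod.mk_eq_zero] at hM
    ext x
    obtain ⟨r, hr, s, hs, rfl⟩ := hx x
    rw [map_add, comm_cen hF M.2 hr, comm_cen hF M.2 hs, hM.1, hM.2]
    simp
  have hEr : LinearMap.range E = LinearMap.ker L := by
    apply le_antisymm
    · rintro _ ⟨M, rfl⟩
      rw [LinearMap.mem_ker]
      ext w
      rw [hL, hE]
      simp [b2 M.2]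
    · rintro ⟨m1, m2⟩ hm
      have hm' : ∀ w, F m1 v w = F u m2 w := by
        intro w
        have := hL (m1, m2) w
        rw [LinearMap.mem_ker.1 hm] at this
        exact (sub_eq_zero.1 this.symm)
      let ev : V → (cen F →ₗ[K] V) := fun x => (LinearMap.applyₗ x).comp (cen F).subtype
      let π : cen F × cen F →ₗ[K] V := (ev u).coprod (ev v)
      let ρ : cen F × cen F →ₗ[K] V := (ev m1).coprod (ev m2)
      have hπ : ∀ t, π t = t.1.1 u + t.2.1 v := fun t => rfl
      have hρ : ∀ t, ρ t = t.1.1 m1 + t.2.1 m2 := fun t => rfl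
      have hπs : LinearMap.range π = ⊤ := by
        rw [LinearMap.range_eq_top]
        intro x
        obtain ⟨r, hr, s, hs, rfl⟩ := hx x
        exact ⟨(⟨r, hr⟩, ⟨s, hs⟩), rfl⟩
      obtain ⟨σ, hσ⟩ := LinearMap.exists_rightInverse_of_surjective π hπs
      have wd : ∀ t, π t = 0 → ρ t = 0 := by
        rintro ⟨⟨r, hr⟩, ⟨s, hs⟩⟩ ht
        rw [hπ] at ht
        rw [hρ]
        simp only at ht ⊢
        apply hzero
        · intro w
          have : F m1 (r u + s v) w = 0 := by rw [ht]; simp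
          rw [map_add, LinearMap.add_apply, b23 hF hs, hm', b23 hF hr] at this
          rw [map_add, LinearMap.add_apply, LinearMap.add_apply, b3 hF hr, b3 hF hs,
            hF.s1 m2, this]
        · intro w
          have : F (r u + s v) m2 w = 0 := by rw [ht]; simp
          rw [map_add, LinearMap.add_apply, LinearMap.add_apply, b3 hF hs, b3 hF hr, ← hm'] at this
          rw [map_add, LinearMap.add_apply, LinearMap.add_apply, b3 hF hr, b3 hF hs,
            hF.s1 m2, this]
      have hM : ∀ t, ρ (σ (π t)) = ρ t := by
        intro t
        rw [← sub_eq_zero, ← map_sub]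
        apply wd
        have := LinearMap.congr_fun hσ (π t)
        simp only [LinearMap.comp_apply, LinearMap.id_apply] at this
        rw [map_sub, this, sub_self]
      have hMc : ρ.comp σ ∈ cen F := by
        intro a b c
        obtain ⟨t, rfl⟩ := LinearMap.range_eq_top.1 hπs a
        obtain ⟨t', rfl⟩ := LinearMap.range_eq_top.1 hπs b
        rw [LinearMap.comp_apply, LinearMap.comp_apply, hM, hM, hπ, hρ, hπ, hρ]
        obtain ⟨⟨r, hr⟩, ⟨s, hs⟩⟩ := t
        obtain ⟨⟨r', hr'⟩, ⟨s', hs'⟩⟩ := t'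
        simp only [map_add, LinearMap.add_apply]
        rw [b3 hF hr, b3 hF hr, b3 hF hr, b3 hF hr, b3 hF hs, b3 hF hs, b3 hF hs, b3 hF hs,
          b23 hF hr', b23 hF hr', b23 hF hr', b23 hF hr', b23 hF hs', b23 hF hs', b23 hF hs',
          b23 hF hs', hm', ← hF.s1 u m1, ← hF.s1 v m2, hF.s1 m2 u, hF.s1 v m1, hm']
      refine ⟨⟨_, hMc⟩, ?_⟩
      rw [hE]
      have e1 := hM (⟨1, one_mem_cen⟩, 0)
      have e2 := hM (0, ⟨1, one_mem_cen⟩)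
      rw [hπ, hρ (⟨1, one_mem_cen⟩, 0)] at e1
      rw [hπ, hρ (0, ⟨1, one_mem_cen⟩)] at e2
      simp only [Module.End.one_apply, ZeroMemClass.coe_zero, LinearMap.zero_apply, add_zero,
        zero_add] at e1 e2
      simp [e1, e2]
  rw [← hk, ← hEr, LinearMap.finrank_range_of_inj hEi]

theorem scalar_of (W : Type*) [AddCommGroup W] [Module K W] (z : End K W)
    (h : ∀ v, ∃ c : K, z v = c • v) : ∃ c : K, ∀ v, z v = c • v := by
  by_cases hz : ∃ v : W, v ≠ 0
  · obtain ⟨v, hv⟩ := hz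
    obtain ⟨c, hc⟩ := h v
    refine ⟨c, fun w => ?_⟩
    obtain ⟨d, hd⟩ := h w
    by_cases hl : ∃ t : K, w = t • v
    · obtain ⟨t, rfl⟩ := hl
      rw [map_smul, hc, smul_comm]
    · obtain ⟨e, he⟩ := h (v + w)
      rw [map_add, hc, hd, smul_add] at he
      have h1 : (d - e) • w = (e - c) • v := by
        rw [sub_smul, sub_smul, sub_eq_sub_iff_add_eq_add, add_comm, he, add_comm]
      by_cases hde : d - e = 0
      · rw [hde, zero_smul] at h1
        have := (smul_eq_zero.1 h1.symm).resolve_right hv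
        have : d = c := by
          rw [sub_eq_zero] at hde this
          rw [hde, this]
        rw [hd, this]
      · exact absurd ⟨(d - e)⁻¹ * (e - c), by rw [mul_smul, ← h1, inv_smul_smul₀ hde]⟩ hl
  · push Not at hz
    exact ⟨0, fun v => by rw [hz v]; simp⟩

theorem stepA (hV : finrank K V = 4) (h2 : ∀ u v, orb F u ⊔ orb F v ≠ ⊤) (u : V) :
    finrank K (orb F u) ≤ 2 := by
  by_contra hc
  have hne : orb F u ≠ ⊤ := fun h => h2 u u (by simp [h])
  obtain ⟨v, hv⟩ : ∃ v, v ∉ orb F u := by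
    by_contra hh
    push Not at hh
    exact hne (eq_top_iff.2 fun x _ => hh x)
  have hlt : orb F u < orb F u ⊔ orb F v := by
    apply lt_of_le_of_ne le_sup_left
    intro he
    apply hv
    rw [he]
    exact Submodule.mem_sup_right (self_mem_orb v)
  have h1 := Submodule.finrank_lt_finrank_of_lt hlt
  have h3 := Submodule.finrank_lt (h2 u v)
  omega

theorem stepC (hF : Good F) (hV : finrank K V = 4) (h2 : ∀ u v, orb F u ⊔ orb F v ≠ ⊤) (u : V)
    (hu : finrank K (orb F u) = 2) (z : End K V) (hz : z ∈ cen F) :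
    ∃ c : K, ∀ x, z x - c • x ∈ orb F u := by
  set U := orb F u with hU
  have hinv : U ≤ U.comap z := fun x hx => orb_inv hF hz hx
  obtain ⟨c, hc⟩ := scalar_of _ (U.mapQ U z hinv) (by
    intro v
    obtain ⟨v, rfl⟩ := U.mkQ_surjective v
    by_contra hcon
    push Not at hcon
    apply h2 u v
    have hq : finrank K (V ⧸ U) = 2 := by
      have := U.finrank_quotient_add_finrank
      omega
    have hli : LinearIndependent K ![U.mkQ v, U.mkQ (z v)] := by
      rw [LinearIndependent.pair_iff']
      · intro a ha
        exact hcon a (by rw [ha]; simp)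
      · intro h0
        apply hcon 0
        rw [h0]; simp
    have hsp := hli.span_eq_top_of_card_eq_finrank' (by simp [hq])
    rw [eq_top_iff]
    intro x _
    have hxx : U.mkQ x ∈ Submodule.span K (Set.range ![U.mkQ v, U.mkQ (z v)]) := by
      rw [hsp]; trivial
    simp only [Matrix.range_cons, Matrix.range_empty, Set.union_empty, Set.singleton_union] at hxx
    obtain ⟨a, b, hab⟩ := Submodule.mem_span_pair.1 hxx
    rw [← map_smul, ← map_smul, ← map_add, ← sub_eq_zero, ← map_sub, Submodule.mkQ_apply,
      Submodule.Quotient.mk_eq_zero] at hab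
    have : x = (-(a • v + b • z v - x)) + (a • v + b • z v) := by abel
    rw [this]
    refine Submodule.add_mem_sup (neg_mem hab) (add_mem ?_ ?_)
    · exact Submodule.smul_mem _ _ (self_mem_orb v)
    · exact Submodule.smul_mem _ _ (apply_mem_orb hz))
  refine ⟨c, fun x => ?_⟩
  have := hc (U.mkQ x)
  rw [← Submodule.Quotient.mk_eq_zero, Submodule.Quotient.mk_sub, sub_eq_zero]
  simpa using this

theorem rankone (hF : Good F) (m : Submodule K (End K V)) (hm : m ≤ cen F) (e : V)
    (he : ∀ z ∈ m, ∀ x, ∃ c : K, z x = c • e) : finrank K m ≤ 1 := by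
  by_cases h0 : m = ⊥
  · rw [h0, finrank_bot]; exact Nat.zero_le 1
  obtain ⟨z1, hz1, hne⟩ := Submodule.exists_mem_ne_zero_of_ne_bot h0
  obtain ⟨x1, hx1⟩ : ∃ x1, z1 x1 ≠ 0 := by
    by_contra hh
    push Not at hh
    exact hne (LinearMap.ext hh)
  obtain ⟨c1, hc1⟩ := he z1 hz1 x1
  have hc1' : c1 ≠ 0 := by rintro rfl; simp at hc1; exact hx1 hc1
  have key : ∀ z ∈ m, z x1 = 0 → z = 0 := by
    intro z hz hzx
    by_contra hzne
    obtain ⟨x, hx⟩ : ∃ x, z x ≠ 0 := by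
      by_contra hh
      push Not at hh
      exact hzne (LinearMap.ext hh)
    obtain ⟨c, hc⟩ := he z hz x
    have hc' : c ≠ 0 := by rintro rfl; simp at hc; exact hx hc
    have h1 : ∀ w, F e x1 w = 0 := by
      intro w
      have := b2 (hm hz) x x1 w
      rw [hzx, hc] at this
      simpa [hc'] using this
    have h2 : e = 0 := by
      apply hF.nd
      intro b w
      have h3 := b2 (hm hz1) b x1 w
      obtain ⟨d, hd⟩ := he z1 hz1 b
      rw [hc1, hd] at h3
      simp [h1, hc1'] at h3
      rw [hF.s1, h3]
    apply hx1
    rw [hc1, h2, smul_zero]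
  refine finrank_le_one ⟨z1, hz1⟩ ?_
  rintro ⟨z, hz⟩
  obtain ⟨c, hc⟩ := he z hz x1
  refine ⟨c * c1⁻¹, ?_⟩
  have := key ((c * c1⁻¹) • z1 - z) (sub_mem (Submodule.smul_mem _ _ hz1) hz) (by
    rw [LinearMap.sub_apply, LinearMap.smul_apply, hc, hc1, smul_smul, mul_assoc,
      inv_mul_cancel₀ hc1', mul_one, sub_self])
  ext1
  exact sub_eq_zero.1 this

theorem cen_dim (hF : Good F) (hV : finrank K V = 4) :
    finrank K (cen F) = 1 ∨ finrank K (cen F) = 2 ∨ finrank K (cen F) = 4 := by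
  by_cases h2 : ∃ u v, orb F u ⊔ orb F v = ⊤
  · obtain ⟨u, v, h⟩ := h2
    exact Or.inr (Or.inr (twogen hF hV u v h))
  push Not at h2
  have : Nontrivial V := Module.nontrivial_of_finrank_pos (R := K) (by omega)
  have hpos : 0 < finrank K (cen F) := by
    rw [Module.finrank_pos_iff_exists_ne_zero]
    refine ⟨⟨1, one_mem_cen⟩, ?_⟩
    intro h
    exact one_ne_zero (congrArg Subtype.val h)
  suffices h : ¬ 3 ≤ finrank K (cen F) by omega
  intro h3
  -- a nonscalar
  obtain ⟨u, hu⟩ : ∃ u, finrank K (orb F u) = 2 := by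
    by_contra hcon
    push Not at hcon
    have hsc : cen F ≤ Submodule.span K {1} := by
      intro z hz
      obtain ⟨c, hc⟩ := scalar_of V z (by
        intro v
        have h1 : finrank K (orb F v) ≤ 1 := by
          have := stepA hV h2 v
          have := hcon v
          omega
        by_cases hv : v = 0
        · exact ⟨0, by simp [hv]⟩
        have hle : Submodule.span K {v} ≤ orb F v := by
          rw [Submodule.span_singleton_le_iff_mem]; exact self_mem_orb v
        have heq := Submodule.eq_of_le_of_finrank_le hle (by rw [finrank_span_singleton hv]; exact h1)
        have : z v ∈ Submodule.span K {v} := by rw [heq]; exact apply_mem_orb hz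
        obtain ⟨c, hc⟩ := Submodule.mem_span_singleton.1 this
        exact ⟨c, hc.symm⟩)
      refine Submodule.mem_span_singleton.2 ⟨c, ?_⟩
      ext x
      simp [hc]
    have := Submodule.finrank_mono hsc
    have := finrank_span_singleton (K := K) (one_ne_zero (α := End K V))
    omega
  set U := orb F u with hU
  let m : Submodule K (End K V) :=
    { carrier := {z | z ∈ cen F ∧ ∀ x, z x ∈ U}
      add_mem' := fun ha hb => ⟨add_mem ha.1 hb.1, fun x => add_mem (ha.2 x) (hb.2 x)⟩
      zero_mem' := ⟨zero_mem _, fun x => zero_mem _⟩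
      smul_mem' := fun c z hz => ⟨Submodule.smul_mem _ _ hz.1, fun x => Submodule.smul_mem _ _ (hz.2 x)⟩ }
  have hmc : m ≤ cen F := fun z hz => hz.1
  have hm2 : 2 ≤ finrank K m := by
    have hle : cen F ≤ m ⊔ Submodule.span K {1} := by
      intro z hz
      obtain ⟨c, hc⟩ := stepC hF hV h2 u hu z hz
      have : z = (z - c • 1) + c • 1 := by abel
      rw [this]
      refine Submodule.add_mem_sup ⟨sub_mem hz (Submodule.smul_mem _ _ one_mem_cen), ?_⟩
        (Submodule.smul_mem _ _ (Submodule.mem_span_singleton_self _))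
      intro x
      simpa using hc x
    have h4 := Submodule.finrank_mono hle
    have h5 := Submodule.finrank_add_le_finrank_add_finrank m (Submodule.span K {(1 : End K V)})
    have := finrank_span_singleton (K := K) (one_ne_zero (α := End K V))
    omega
  have hUt : ∃ v, v ∉ U := by
    by_contra hh
    push Not at hh
    exact h2 u u (by rw [sup_idem]; exact eq_top_iff.2 fun x _ => hh x)
  by_cases hex : ∃ v, v ∉ U ∧ ∃ z ∈ m, z v ≠ 0
  · obtain ⟨v, hv, z, hz, hzv⟩ := hex
    have hlt : U ⊓ orb F v < orb F v := by
      apply lt_of_le_of_ne inf_le_right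
      intro he
      have := self_mem_orb (F := F) v
      rw [← he] at this
      exact hv this.1
    have hin : z v ∈ U ⊓ orb F v := ⟨hz.2 v, apply_mem_orb hz.1⟩
    have hp : 0 < finrank K ↥(U ⊓ orb F v) := by
      rw [Module.finrank_pos_iff_exists_ne_zero]
      exact ⟨⟨_, hin⟩, fun h => hzv (congrArg Subtype.val h)⟩
    have h5 := Submodule.finrank_lt_finrank_of_lt hlt
    have h6 := stepA hV h2 v
    have hv2 : finrank K (orb F v) = 2 := by omega
    obtain ⟨w, hw⟩ : ∃ w, w ∉ U ⊔ orb F v := by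
      by_contra hh
      push Not at hh
      exact h2 u v (eq_top_iff.2 fun x _ => hh x)
    have hall : ∀ y ∈ m, ∀ x, y x ∈ U ⊓ orb F v := by
      intro y hy x
      refine ⟨hy.2 x, ?_⟩
      obtain ⟨c, hc⟩ := stepC hF hV h2 v hv2 y hy.1
      by_cases hc0 : c = 0
      · simpa [hc0] using hc x
      · exfalso
        apply hw
        have : c • w ∈ U ⊔ orb F v := by
          have e : c • w = y w + (-(y w - c • w)) := by abel
          rw [e]
          exact Submodule.add_mem_sup (hy.2 w) (neg_mem (hc w))
        exact (Submodule.smul_mem_iff _ hc0).1 this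
    have h7 : finrank K ↥(U ⊓ orb F v) ≤ 1 := by omega
    obtain ⟨e, he⟩ := finrank_le_one_iff.1 h7
    have := rankone hF m hmc e.1 (by
      intro y hy x
      obtain ⟨c, hc⟩ := he ⟨y x, hall y hy x⟩
      exact ⟨c, (congrArg Subtype.val hc).symm⟩)
    omega
  · push Not at hex
    have : m = ⊥ := by
      rw [eq_bot_iff]
      intro z hz
      rw [Submodule.mem_bot]
      ext x
      by_cases hx : x ∈ U
      · obtain ⟨v, hv⟩ := hUt
        have h1 := hex v hv z hz
        have h4 := hex (v + x) (fun h => hv (by simpa using sub_mem h hx)) z hz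
        rw [map_add, h1, zero_add] at h4
        simpa using h4
      · simpa using hex x hx z hz
    rw [this] at hm2
    simp at hm2

end CubicCentre

namespace CubicCentre
open Module

variable {K : Type*} [Field K]

local notation "PP" => MvPolynomial (Fin 4) K
local notation "HH" => homogeneousSubmodule (Fin 4) K

theorem finrank_H2 : finrank K (HH 2) = 10 := by
  rw [homogeneousSubmodule_eq_finsupp_supported,
    (AddMonoidAlgebra.supportedEquivFinsupp (R := K) (S := K)
      {d : Fin 4 →₀ ℕ | d.degree = 2}).finrank_eq]
  have hs : {d : Fin 4 →₀ ℕ | d.degree = 2} =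
      ((Finset.univ : Finset (Fin 4)).finsuppAntidiag 2 : Set _) := by
    ext d
    simp [Finset.mem_finsuppAntidiag, Finsupp.degree_eq_sum]
  rw [hs]
  rw [Module.finrank_finsupp_self]
  simp [Finset.card_finsuppAntidiag_nat_eq_choose, Nat.choose]

theorem phi_hom {Φ : PP →ₗ[K] K}
    (hΦ : ∀ m : Fin 4 →₀ ℕ, (m.sum fun _ e => e) ≠ 3 → Φ (monomial m 1) = 0)
    {n : ℕ} (hn : n ≠ 3) {f : PP} (hf : f ∈ HH n) : Φ f = 0 := by
  rw [f.as_sum, map_sum]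
  refine Finset.sum_eq_zero fun d hd => ?_
  have h1 : d.degree = n := by
    by_contra h
    exact (mem_support_iff.1 hd) (IsHomogeneous.coeff_eq_zero hf h)
  have h2 : monomial d (coeff d f) = coeff d f • (monomial d 1 : PP) := by
    rw [smul_monomial, smul_eq_mul, mul_one]
  rw [h2, map_smul, hΦ d, smul_zero]
  intro h
  apply hn
  rw [← h1, ← h]
  rfl

theorem H_le {n : ℕ} (S : Submodule K PP) (h : ∀ i, ∀ g ∈ HH n, X i * g ∈ S) : HH (n + 1) ≤ S := by
  rw [← homogeneousSubmodule_one_pow, add_comm, pow_add, pow_one, homogeneousSubmodule_one_pow,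
    Submodule.mul_le]
  intro a ha g hg
  rw [homogeneousSubmodule_one_eq_span_X] at ha
  induction ha using Submodule.span_induction with
  | mem x hx =>
    obtain ⟨i, rfl⟩ := hx
    exact h i g hg
  | zero => simp
  | add x y _ _ hx hy => rw [add_mul]; exact add_mem hx hy
  | smul c x _ hx => rw [smul_mul_assoc]; exact Submodule.smul_mem _ _ hx

theorem mem_ann_of_hom {Φ : PP →ₗ[K] K}
    (hΦ : ∀ m : Fin 4 →₀ ℕ, (m.sum fun _ e => e) ≠ 3 → Φ (monomial m 1) = 0)
    {n : ℕ} {f : PP} (hf : f ∈ HH n)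
    (h : ∀ m, n + m = 3 → ∀ g ∈ HH m, Φ (f * g) = 0) : f ∈ annIdeal K Φ := by
  intro g
  rw [g.as_sum, Finset.mul_sum, map_sum]
  refine Finset.sum_eq_zero fun d _ => ?_
  have hd : (monomial d (coeff d g) : PP) ∈ HH d.degree := isHomogeneous_monomial _ rfl
  by_cases h3 : n + d.degree = 3
  · exact h _ h3 _ hd
  · exact phi_hom hΦ h3 (IsHomogeneous.mul hf hd)

theorem sum_comp (f : PP) : ∃ N, f = ∑ i ∈ Finset.range N, homogeneousComponent i f :=
  ⟨_, (sum_homogeneousComponent f).symm⟩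

theorem comp_mem_H (n : ℕ) (f : PP) : homogeneousComponent n f ∈ HH n :=
  homogeneousComponent_mem _ _

theorem comp_mem {Φ : PP →ₗ[K] K}
    (hΦ : ∀ m : Fin 4 →₀ ℕ, (m.sum fun _ e => e) ≠ 3 → Φ (monomial m 1) = 0)
    {f : PP} (hf : f ∈ annIdeal K Φ) (n : ℕ) : homogeneousComponent n f ∈ annIdeal K Φ := by
  apply mem_ann_of_hom hΦ (comp_mem_H n f)
  intro m hm g hg
  have h1 : Φ (f * g) = Φ (homogeneousComponent n f * g) := by
    conv_lhs => rw [← sum_homogeneousComponent f]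
    rw [Finset.sum_mul, map_sum]
    apply Finset.sum_eq_single n
    · intro i _ hi
      exact phi_hom hΦ (n := i + m) (by omega) (IsHomogeneous.mul (comp_mem_H i f) hg)
    · intro h
      have : homogeneousComponent n f = 0 := by
        apply homogeneousComponent_eq_zero
        simpa using h
      simp [this]
  rw [← h1]
  exact hf g

theorem phi_comp {Φ : PP →ₗ[K] K} (hΦ : ∀ n ≠ 3, ∀ f ∈ HH n, Φ f = 0) (f : PP) :
    Φ f = Φ (homogeneousComponent 3 f) := by
  conv_lhs => rw [← sum_homogeneousComponent f]
  rw [map_sum]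
  apply Finset.sum_eq_single 3
  · intro i _ hi
    exact hΦ i hi _ (comp_mem_H i f)
  · intro h
    have : homogeneousComponent 3 f = 0 := by
      apply homogeneousComponent_eq_zero
      simpa using h
    simp [this]

theorem comp_X_mul (n : ℕ) (i : Fin 4) (f : PP) :
    homogeneousComponent (n + 1) (X i * f) = X i * homogeneousComponent n f := by
  induction f using MvPolynomial.induction_on' with
  | monomial d c =>
    have h1 : (monomial d c : PP) ∈ HH d.degree := isHomogeneous_monomial _ rfl
    have h2 : (X i * monomial d c : PP) ∈ HH (1 + d.degree) :=
      IsHomogeneous.mul (isHomogeneous_X _ i) h1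
    rw [homogeneousComponent_of_mem h1, homogeneousComponent_of_mem h2]
    by_cases h : n = d.degree
    · rw [if_pos (by omega), if_pos (by omega)]
    · rw [if_neg (by omega), if_neg (by omega), mul_zero]
  | add p q hp hq => rw [mul_add, map_add, hp, hq, map_add, mul_add]

/-- Linear forms. -/
def ell (K : Type*) [Field K] : (Fin 4 → K) →ₗ[K] MvPolynomial (Fin 4) K :=
  Fintype.linearCombination K (fun i => (X i : MvPolynomial (Fin 4) K))

theorem ell_apply (a : Fin 4 → K) : ell K a = ∑ i, a i • (X i : PP) := rfl

theorem ell_single (i : Fin 4) : ell K (Pi.single i 1) = X i := by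
  simp [ell]

theorem ell_range : LinearMap.range (ell K) = HH 1 := by
  rw [ell, Fintype.range_linearCombination, homogeneousSubmodule_one_eq_span_X]

theorem ell_mem (a : Fin 4 → K) : ell K a ∈ HH 1 := by
  rw [← ell_range]; exact LinearMap.mem_range_self _ _

theorem ell_inj : Function.Injective (ell K) := by
  have := MvPolynomial.linearIndependent_X (σ := Fin 4) (R := K)
  rw [Fintype.linearIndependent_iff] at this
  rw [← LinearMap.ker_eq_bot, LinearMap.ker_eq_bot']
  intro a ha
  exact funext (this a ha)

/-- The trilinear form. -/
def tri (Φ : PP →ₗ[K] K) :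
    (Fin 4 → K) →ₗ[K] (Fin 4 → K) →ₗ[K] (Fin 4 → K) →ₗ[K] K :=
  LinearMap.mk₂ K (fun a b => Φ.comp ((LinearMap.mulLeft K (ell K a * ell K b)).comp (ell K)))
    (by intro a a' b; ext c; simp [add_mul, mul_assoc])
    (by intro r a b; ext c; simp [mul_assoc])
    (by intro a b b'; ext c; simp [add_mul, mul_add, mul_assoc])
    (by intro r a b; ext c; simp [mul_assoc])

theorem tri_apply (Φ : PP →ₗ[K] K) (a b c : Fin 4 → K) :
    tri Φ a b c = Φ (ell K a * ell K b * ell K c) := rfl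

theorem H2_le (S : Submodule K PP) (h : ∀ b c, ell K b * ell K c ∈ S) : HH 2 ≤ S := by
  apply H_le
  intro i g hg
  rw [← ell_range] at hg
  obtain ⟨c, rfl⟩ := hg
  rw [← ell_single]
  exact h _ _

theorem tri_good {Φ : PP →ₗ[K] K}
    (hΦ : ∀ m : Fin 4 →₀ ℕ, (m.sum fun _ e => e) ≠ 3 → Φ (monomial m 1) = 0)
    (hlin : ∀ u ∈ HH 1, u ∈ annIdeal K Φ → u = 0) : Good (tri Φ) where
  s1 := by intro a b c; rw [tri_apply, tri_apply, mul_comm (ell K a)]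
  s2 := by intro a b c; rw [tri_apply, tri_apply, mul_right_comm]
  nd := by
    intro a h
    apply ell_inj
    rw [map_zero]
    apply hlin _ (ell_mem a)
    apply mem_ann_of_hom hΦ (ell_mem a)
    intro m hm g hg
    obtain rfl : m = 2 := by omega
    have : HH 2 ≤ LinearMap.ker (Φ.comp (LinearMap.mulLeft K (ell K a))) := by
      apply H2_le
      intro b c
      have := h b c
      rw [tri_apply, mul_assoc] at this
      simpa using this
    simpa using this hg

theorem exists_q {Φ : PP →ₗ[K] K}
    (hΦ : ∀ m : Fin 4 →₀ ℕ, (m.sum fun _ e => e) ≠ 3 → Φ (monomial m 1) = 0)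
    (hlin : ∀ u ∈ HH 1, u ∈ annIdeal K Φ → u = 0) :
    Function.Surjective ((LinearMap.pi fun i => Φ.comp (LinearMap.mulLeft K (X i : PP))).domRestrict
      (HH 2)) := by
  rw [← LinearMap.range_eq_top]
  by_contra hne
  obtain ⟨f, hf, hle⟩ := Submodule.exists_le_ker_of_lt_top _ (lt_top_iff_ne_top.2 hne)
  apply hf
  have hfa : ∀ x, f x = ∑ i, f (Pi.single i 1) * x i := by
    intro x
    conv_lhs => rw [← LinearMap.sum_single_apply (fun _ : Fin 4 => K) x, map_sum]
    refine Finset.sum_congr rfl fun i _ => ?_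
    have : (Pi.single i (x i) : Fin 4 → K) = x i • Pi.single i 1 := by
      ext j; simp [Pi.single_apply]
    rw [this, map_smul, smul_eq_mul, mul_comm]
  set a : Fin 4 → K := fun i => f (Pi.single i 1) with ha
  have h0 : a = 0 := by
    apply ell_inj
    rw [map_zero]
    apply hlin _ (ell_mem a)
    apply mem_ann_of_hom hΦ (ell_mem a)
    intro m hm g hg
    obtain rfl : m = 2 := by omega
    have := hle (LinearMap.mem_range_self _ ⟨g, hg⟩)
    rw [LinearMap.mem_ker, hfa] at this
    rw [ell_apply, Finset.sum_mul, map_sum, ← this]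
    refine Finset.sum_congr rfl fun i _ => ?_
    simp [ha]
  ext i
  have := congrFun h0 i
  simpa [ha] using this

end CubicCentre

namespace CubicCentre
open Module

variable {K : Type*} [Field K]

local notation "PP" => MvPolynomial (Fin 4) K
local notation "HH" => homogeneousSubmodule (Fin 4) K

/-- Quadrics in the annihilator. -/
def I2 (Φ : PP →ₗ[K] K) : Submodule K PP := HH 2 ⊓ (annIdeal K Φ).restrictScalars K

/-- Cubics in the annihilator. -/
def I3 (Φ : PP →ₗ[K] K) : Submodule K PP := HH 3 ⊓ (annIdeal K Φ).restrictScalars K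

/-- Cubics generated by the quadrics in the annihilator. -/
def WW (Φ : PP →ₗ[K] K) : Submodule K PP :=
  Submodule.span K {f | ∃ i, ∃ g ∈ I2 Φ, f = X i * g}

/-- Polynomials whose cubic part is in `WW`. -/
def Wp (Φ : PP →ₗ[K] K) : Submodule K PP := (WW Φ).comap (homogeneousComponent 3)

theorem mem_I2 {Φ : PP →ₗ[K] K}
    (hΦ : ∀ m : Fin 4 →₀ ℕ, (m.sum fun _ e => e) ≠ 3 → Φ (monomial m 1) = 0)
    {g : PP} (hg : g ∈ HH 2) (h : ∀ i, Φ (X i * g) = 0) : g ∈ I2 Φ := by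
  refine ⟨hg, ?_⟩
  change g ∈ annIdeal K Φ
  apply mem_ann_of_hom hΦ hg
  intro m hm f hf
  obtain rfl : m = 1 := by omega
  rw [← ell_range] at hf
  obtain ⟨a, rfl⟩ := hf
  rw [ell_apply, Finset.mul_sum, map_sum]
  refine Finset.sum_eq_zero fun i _ => ?_
  rw [mul_smul_comm, map_smul, mul_comm, h, smul_zero]

theorem mem_I3 {Φ : PP →ₗ[K] K}
    (hΦ : ∀ m : Fin 4 →₀ ℕ, (m.sum fun _ e => e) ≠ 3 → Φ (monomial m 1) = 0)
    {g : PP} (hg : g ∈ HH 3) (h : Φ g = 0) : g ∈ I3 Φ := by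
  refine ⟨hg, ?_⟩
  change g ∈ annIdeal K Φ
  apply mem_ann_of_hom hΦ hg
  intro m hm f hf
  obtain rfl : m = 0 := by omega
  rw [homogeneousSubmodule_zero] at hf
  obtain ⟨c, rfl⟩ := Submodule.mem_one.1 hf
  rw [mul_comm, ← Algebra.smul_def, map_smul, h, smul_zero]

theorem finrank_I2 {Φ : PP →ₗ[K] K}
    (hΦ : ∀ m : Fin 4 →₀ ℕ, (m.sum fun _ e => e) ≠ 3 → Φ (monomial m 1) = 0)
    (hlin : ∀ u ∈ HH 1, u ∈ annIdeal K Φ → u = 0) : finrank K (I2 Φ) = 6 := by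
  have hs := exists_q hΦ hlin
  set D := ((LinearMap.pi fun i => Φ.comp (LinearMap.mulLeft K (X i : PP))).domRestrict
      (HH 2)) with hD
  have : FiniteDimensional K (HH 2) := Module.finite_of_finrank_pos (by rw [finrank_H2]; norm_num)
  have h1 := LinearMap.finrank_range_add_finrank_ker D
  rw [LinearMap.range_eq_top.2 hs, finrank_top, finrank_H2] at h1
  have h2 : (LinearMap.ker D).map (HH 2).subtype = I2 Φ := by
    ext g
    constructor
    · rintro ⟨⟨g, hg⟩, hk, rfl⟩
      apply mem_I2 hΦ hg
      intro i
      exact congrFun (LinearMap.mem_ker.1 hk) i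
    · rintro ⟨hg, hk⟩
      refine ⟨⟨g, hg⟩, ?_, rfl⟩
      apply LinearMap.mem_ker.2
      ext i
      have := hk (X i)
      rw [mul_comm] at this
      exact this
  rw [← h2, Submodule.finrank_map_subtype_eq]
  simp at h1
  omega

theorem exists_dual {Φ : PP →ₗ[K] K}
    (hΦ : ∀ m : Fin 4 →₀ ℕ, (m.sum fun _ e => e) ≠ 3 → Φ (monomial m 1) = 0)
    (hlin : ∀ u ∈ HH 1, u ∈ annIdeal K Φ → u = 0) :
    ∃ q : Fin 4 → PP, (∀ j, q j ∈ HH 2) ∧ ∀ i j, Φ (X i * q j) = if i = j then 1 else 0 := by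
  have hs := exists_q hΦ hlin
  choose q hq using fun j : Fin 4 => hs (Pi.single j 1)
  refine ⟨fun j => (q j).1, fun j => (q j).2, fun i j => ?_⟩
  have := congrFun (hq j) i
  rw [Pi.single_apply] at this
  exact this

theorem three_eq {i j l i' j' l' : Fin 4} (T : Fin 4 → Fin 4 → Fin 4 → K)
    (s1 : ∀ a b c, T a b c = T b a c) (s2 : ∀ a b c, T a b c = T a c b)
    (h : Finsupp.single i 1 + Finsupp.single j 1 + Finsupp.single l 1 =
      (Finsupp.single i' 1 + Finsupp.single j' 1 + Finsupp.single l' 1 : Fin 4 →₀ ℕ)) :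
    T i j l = T i' j' l' := by
  have h' := congrArg Finsupp.toMultiset h
  simp only [map_add, Finsupp.toMultiset_single, one_smul] at h'
  have hp : [i, j, l].Perm [i', j', l'] := by
    rw [← Multiset.coe_eq_coe]
    exact h'
  have two : ∀ a b a' b' : Fin 4, [a, b].Perm [a', b'] → ∀ c, T c a b = T c a' b' := by
    intro a b a' b' hab c
    have hm : a' ∈ [a, b] := hab.symm.subset (by simp)
    simp only [List.mem_cons, List.not_mem_nil, or_false] at hm
    rcases hm with rfl | rfl
    · have := (List.perm_cons _).1 hab
      rw [List.singleton_perm_singleton.1 this]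
    · have := (List.perm_cons _).1 ((List.Perm.swap _ _ _).trans hab)
      rw [List.singleton_perm_singleton.1 this, s2]
  have hm : i' ∈ [i, j, l] := hp.symm.subset (by simp)
  simp only [List.mem_cons, List.not_mem_nil, or_false] at hm
  rcases hm with rfl | rfl | rfl
  · exact two _ _ _ _ ((List.perm_cons _).1 hp) _
  · rw [s1]
    exact two _ _ _ _ ((List.perm_cons _).1 ((List.Perm.swap _ _ _).trans hp)) _
  · rw [s2, s1]
    have hq : [i', i, j].Perm [i, j, i'] :=
      (List.Perm.swap _ _ _).trans ((List.Perm.swap _ _ _).cons _)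
    exact two _ _ _ _ ((List.perm_cons _).1 (hq.trans hp)) _

theorem exists_functional (T : (Fin 4 → K) →ₗ[K] (Fin 4 → K) →ₗ[K] (Fin 4 → K) →ₗ[K] K)
    (s1 : ∀ a b c, T a b c = T b a c) (s2 : ∀ a b c, T a b c = T a c b) :
    ∃ Ψ : PP →ₗ[K] K, (∀ n ≠ 3, ∀ f ∈ HH n, Ψ f = 0) ∧
      ∀ a b c, Ψ (ell K a * ell K b * ell K c) = T a b c := by
  classical
  let e : Fin 4 → (Fin 4 → K) := fun i => Pi.single i 1
  let mon : Fin 4 × Fin 4 × Fin 4 → (Fin 4 →₀ ℕ) := fun t =>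
    Finsupp.single t.1 1 + Finsupp.single t.2.1 1 + Finsupp.single t.2.2 1
  let val : (Fin 4 →₀ ℕ) → K := fun m =>
    if h : ∃ t, mon t = m then T (e h.choose.1) (e h.choose.2.1) (e h.choose.2.2) else 0
  have hval : ∀ i j l, val (mon (i, j, l)) = T (e i) (e j) (e l) := by
    intro i j l
    have h : ∃ t, mon t = mon (i, j, l) := ⟨_, rfl⟩
    simp only [val, dif_pos h]
    exact three_eq (fun a b c => T (e a) (e b) (e c)) (fun _ _ _ => s1 _ _ _)
      (fun _ _ _ => s2 _ _ _) h.choose_spec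
  let Ψ : PP →ₗ[K] K := (basisMonomials (Fin 4) K).constr K val
  have hΨ : ∀ m, Ψ (monomial m 1) = val m := by
    intro m
    have := (basisMonomials (Fin 4) K).constr_basis K val m
    simpa using this
  refine ⟨Ψ, ?_, ?_⟩
  · intro n hn f hf
    refine phi_hom ?_ hn hf
    intro m hm
    rw [hΨ]
    apply dif_neg
    rintro ⟨t, rfl⟩
    apply hm
    change (mon t).degree = 3
    simp [mon]
  · have hX : ∀ i j l, Ψ (X i * X j * X l) = T (e i) (e j) (e l) := by
      intro i j l
      rw [← hval, ← hΨ]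
      simp [mon, X, monomial_mul]
    intro a b c
    have hT : ∀ x : Fin 4 → K, x = ∑ i, x i • e i := by
      intro x
      ext j
      simp [e, Pi.single_apply]
    conv_rhs => rw [hT a, hT b, hT c]
    simp only [ell_apply, Finset.sum_mul, Finset.mul_sum, map_sum, LinearMap.sum_apply,
      smul_mul_assoc, mul_smul_comm, map_smul, LinearMap.smul_apply, hX]

end CubicCentre

namespace CubicCentre
open Module

universe u
variable {K : Type*} [Field K]

local notation "PP" => MvPolynomial (Fin 4) K
local notation "HH" => homogeneousSubmodule (Fin 4) K

theorem WW_le_H {Φ : PP →ₗ[K] K} : WW Φ ≤ HH 3 := by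
  rw [WW, Submodule.span_le]
  rintro _ ⟨i, g, hg, rfl⟩
  exact IsHomogeneous.mul (isHomogeneous_X _ i) hg.1

theorem WW_le_ann {Φ : PP →ₗ[K] K} : WW Φ ≤ (annIdeal K Φ).restrictScalars K := by
  rw [WW, Submodule.span_le]
  rintro _ ⟨i, g, hg, rfl⟩
  exact Ideal.mul_mem_left _ _ hg.2

theorem mem_Wp_of_H {Φ : PP →ₗ[K] K} {f : PP} (hf : f ∈ HH 3) : f ∈ Wp Φ ↔ f ∈ WW Φ := by
  rw [Wp, Submodule.mem_comap, homogeneousComponent_of_mem hf, if_pos rfl]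

theorem sub_comp_mem_Wp {Φ : PP →ₗ[K] K} (f : PP) : f - homogeneousComponent 3 f ∈ Wp Φ := by
  rw [Wp, Submodule.mem_comap, map_sub, homogeneousComponent_of_mem (comp_mem_H 3 f), if_pos rfl,
    sub_self]
  exact zero_mem _

theorem ell_mul_mem {Φ : PP →ₗ[K] K} (a : Fin 4 → K) {g : PP} (hg : g ∈ I2 Φ) :
    ell K a * g ∈ WW Φ := by
  rw [ell_apply, Finset.sum_mul]
  refine sum_mem fun i _ => ?_
  rw [smul_mul_assoc]
  exact Submodule.smul_mem _ _ (Submodule.subset_span ⟨i, g, hg, rfl⟩)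

/-- The endomorphism attached to a functional. -/
def mm (q : Fin 4 → PP) : Dual K PP →ₗ[K] End K (Fin 4 → K) where
  toFun Ψ := LinearMap.pi fun j => Ψ.comp ((LinearMap.mulRight K (q j)).comp (ell K))
  map_add' := by intro Ψ Ψ'; ext; simp
  map_smul' := by intro r Ψ; ext; simp

theorem mm_apply (q : Fin 4 → PP) (Ψ : Dual K PP) (a : Fin 4 → K) (j : Fin 4) :
    mm q Ψ a j = Ψ (ell K a * q j) := rfl

theorem finrank_dual {Φ : PP →ₗ[K] K}
    (hΦ : ∀ m : Fin 4 →₀ ℕ, (m.sum fun _ e => e) ≠ 3 → Φ (monomial m 1) = 0)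
    (hlin : ∀ u ∈ HH 1, u ∈ annIdeal K Φ → u = 0) :
    finrank K (Wp Φ).dualAnnihilator = finrank K (cen (tri Φ)) := by
  obtain ⟨q, hq, hqd⟩ := exists_dual hΦ hlin
  have hgood := tri_good hΦ hlin
  have hell : ∀ (a : Fin 4 → K) (g : PP), Φ (ell K a * g) = ∑ i, a i * Φ (X i * g) := by
    intro a g
    rw [ell_apply, Finset.sum_mul, map_sum]
    simp
  have key : ∀ Ψ ∈ (Wp Φ).dualAnnihilator, ∀ a, ∀ g ∈ HH 2,
      Ψ (ell K a * g) = Φ (ell K (mm q Ψ a) * g) := by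
    intro Ψ hΨ a g hg
    have h1 : g - ∑ j, Φ (X j * g) • q j ∈ I2 Φ := by
      apply mem_I2 hΦ (sub_mem hg (sum_mem fun j _ => Submodule.smul_mem _ _ (hq j)))
      intro i
      rw [mul_sub, map_sub, Finset.mul_sum, map_sum]
      simp [hqd]
    have h2 := ell_mul_mem a h1
    have h3 := (Submodule.mem_dualAnnihilator Ψ).1 hΨ _ ((mem_Wp_of_H (WW_le_H h2)).2 h2)
    rw [mul_sub, map_sub, sub_eq_zero] at h3
    rw [h3, hell, Finset.mul_sum, map_sum]
    refine Finset.sum_congr rfl fun j _ => ?_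
    rw [mul_smul_comm, map_smul, smul_eq_mul, mm_apply, mul_comm]
  let L : (Wp Φ).dualAnnihilator →ₗ[K] End K (Fin 4 → K) :=
    (mm q).comp (Wp Φ).dualAnnihilator.subtype
  have hLi : Function.Injective L := by
    rintro ⟨Ψ1, hΨ1⟩ ⟨Ψ2, hΨ2⟩ h0
    have h00 : mm q Ψ1 = mm q Ψ2 := h0
    obtain ⟨Ψ, rfl⟩ : ∃ Ψ, Ψ1 = Ψ + Ψ2 := ⟨Ψ1 - Ψ2, (sub_add_cancel _ _).symm⟩
    have hΨ : Ψ ∈ (Wp Φ).dualAnnihilator := by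
      have h := sub_mem hΨ1 hΨ2
      rwa [add_sub_cancel_right] at h
    have h0' : mm q Ψ = 0 := by
      rw [map_add] at h00
      exact add_eq_right.1 h00
    have h1 : HH 3 ≤ LinearMap.ker Ψ := by
      apply H_le
      intro i g hg
      rw [LinearMap.mem_ker, ← ell_single, key Ψ hΨ _ g hg, h0']
      simp
    have h3 : Ψ = 0 := by
      apply LinearMap.ext
      intro f
      have h2 := (Submodule.mem_dualAnnihilator Ψ).1 hΨ _ (sub_comp_mem_Wp f)
      rw [map_sub, LinearMap.mem_ker.1 (h1 (comp_mem_H 3 f)), sub_zero] at h2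
      simpa using h2
    apply Subtype.ext
    change Ψ + Ψ2 = Ψ2
    rw [h3]
    exact zero_add _
  have hLr : LinearMap.range L = cen (tri Φ) := by
    apply le_antisymm
    · rintro _ ⟨⟨Ψ, hΨ⟩, rfl⟩
      change mm q Ψ ∈ _
      intro a b c
      have hH : ∀ x y : Fin 4 → K, ell K x * ell K y ∈ HH 2 := fun x y =>
        IsHomogeneous.mul (ell_mem x) (ell_mem y)
      have e1 : tri Φ (mm q Ψ a) b c = Ψ (ell K a * (ell K b * ell K c)) := by
        rw [tri_apply, mul_assoc, ← key Ψ hΨ _ _ (hH _ _)]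
      have e2 : tri Φ a (mm q Ψ b) c = Ψ (ell K b * (ell K a * ell K c)) := by
        rw [hgood.s1, tri_apply, mul_assoc, ← key Ψ hΨ _ _ (hH _ _)]
      rw [e1, e2]
      congr 1
      ring
    · intro M hM
      obtain ⟨Ψ, hΨ0, hΨ⟩ := exists_functional ((tri Φ).comp M)
        (by
          intro a b c
          rw [LinearMap.comp_apply, LinearMap.comp_apply, b2 hM, hgood.s1])
        (by
          intro a b c
          rw [LinearMap.comp_apply, hgood.s2])
      have h1 : ∀ a, ∀ g ∈ HH 2, Ψ (ell K a * g) = Φ (ell K (M a) * g) := by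
        intro a g hg
        have : HH 2 ≤ LinearMap.ker (Ψ.comp (LinearMap.mulLeft K (ell K a)) -
            Φ.comp (LinearMap.mulLeft K (ell K (M a)))) := by
          apply H2_le
          intro b c
          have := hΨ a b c
          rw [LinearMap.comp_apply, tri_apply, mul_assoc, mul_assoc] at this
          simp [this]
        have h := this hg
        simp only [LinearMap.mem_ker, LinearMap.sub_apply, LinearMap.comp_apply,
          LinearMap.mulLeft_apply] at h
        exact sub_eq_zero.1 h
      have h2 : Ψ ∈ (Wp Φ).dualAnnihilator := by
        rw [Submodule.mem_dualAnnihilator]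
        intro f hf
        rw [phi_comp hΨ0]
        have hle : WW Φ ≤ LinearMap.ker Ψ := by
          rw [WW, Submodule.span_le]
          rintro _ ⟨i, g, hg, rfl⟩
          have hh := h1 (Pi.single i 1) g hg.1
          rw [ell_single] at hh
          change Ψ _ = 0
          rw [hh, mul_comm]
          exact hg.2 _
        exact hle hf
      refine ⟨⟨Ψ, h2⟩, ?_⟩
      change mm q Ψ = M
      apply LinearMap.ext
      intro a
      funext j
      rw [mm_apply, h1 a _ (hq j), hell]
      simp [hqd]
  rw [← hLr, LinearMap.finrank_range_of_inj hLi]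

theorem finrank_T {Φ : PP →ₗ[K] K}
    (hΦ : ∀ m : Fin 4 →₀ ℕ, (m.sum fun _ e => e) ≠ 3 → Φ (monomial m 1) = 0)
    (hlin : ∀ u ∈ HH 1, u ∈ annIdeal K Φ → u = 0) :
    finrank K (PP ⧸ Wp Φ) = finrank K (cen (tri Φ)) := by
  rw [← finrank_dual hΦ hlin, ← (Submodule.dualQuotEquivDualAnnihilator (Wp Φ)).finrank_eq,
    Subspace.dual_finrank_eq]

/-- The cubic generators. -/
def J3 (Φ : PP →ₗ[K] K) : Submodule K (PP ⧸ Wp Φ) := (I3 Φ).map (Wp Φ).mkQ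

theorem finrank_J3 {Φ : PP →ₗ[K] K}
    (hΦ : ∀ m : Fin 4 →₀ ℕ, (m.sum fun _ e => e) ≠ 3 → Φ (monomial m 1) = 0)
    (hlin : ∀ u ∈ HH 1, u ∈ annIdeal K Φ → u = 0) (hfd : FiniteDimensional K (PP ⧸ Wp Φ)) :
    finrank K (J3 Φ) + 1 = finrank K (cen (tri Φ)) := by
  have hΦ0 : ∀ n ≠ 3, ∀ f ∈ HH n, Φ f = 0 := fun n hn f hf => phi_hom hΦ hn hf
  have hk : Wp Φ ≤ LinearMap.ker Φ := by
    intro f hf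
    rw [LinearMap.mem_ker, phi_comp hΦ0]
    have := WW_le_ann hf (1 : PP)
    rwa [mul_one] at this
  let φ : (PP ⧸ Wp Φ) →ₗ[K] K := (Wp Φ).liftQ Φ hk
  have hφ : ∀ f, φ ((Wp Φ).mkQ f) = Φ f := fun f => by simp [φ]
  have hker : LinearMap.ker φ = J3 Φ := by
    ext x
    constructor
    · intro hx
      obtain ⟨f, rfl⟩ := (Wp Φ).mkQ_surjective x
      rw [LinearMap.mem_ker, hφ, phi_comp hΦ0] at hx
      refine ⟨homogeneousComponent 3 f, mem_I3 hΦ (comp_mem_H 3 f) hx, ?_⟩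
      rw [eq_comm, ← sub_eq_zero, ← map_sub, Submodule.mkQ_apply, Submodule.Quotient.mk_eq_zero]
      exact sub_comp_mem_Wp f
    · rintro ⟨f, hf, rfl⟩
      rw [LinearMap.mem_ker, hφ]
      have := hf.2 (1 : PP)
      rwa [mul_one] at this
  have hs : Function.Surjective φ := by
    apply LinearMap.surjective
    intro h0
    obtain ⟨q, hq, hqd⟩ := exists_dual hΦ hlin
    have h1 := hqd 0 0
    rw [← hφ, h0] at h1
    simp at h1
  have h1 := LinearMap.finrank_range_add_finrank_ker φ
  rw [LinearMap.range_eq_top.2 hs, finrank_top, hker, finrank_T hΦ hlin, finrank_self] at h1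
  omega

theorem comp_low {Φ : PP →ₗ[K] K}
    (hΦ : ∀ m : Fin 4 →₀ ℕ, (m.sum fun _ e => e) ≠ 3 → Φ (monomial m 1) = 0)
    (hlin : ∀ u ∈ HH 1, u ∈ annIdeal K Φ → u = 0) {f : PP} (hf : f ∈ annIdeal K Φ) :
    homogeneousComponent 0 f = 0 ∧ homogeneousComponent 1 f = 0 := by
  refine ⟨?_, hlin _ (comp_mem_H 1 f) (comp_mem hΦ hf 1)⟩
  have h0 := comp_mem hΦ hf 0
  rw [homogeneousComponent_zero] at h0 ⊢
  have h1 : (C (coeff 0 f) * X 0 : PP) = 0 := by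
    apply hlin
    · exact isHomogeneous_C_mul_X _ _
    · exact Ideal.mul_mem_right _ _ h0
  rcases mul_eq_zero.1 h1 with h | h
  · exact h
  · exact absurd h (X_ne_zero 0)

/-- The map detecting minimal generators. -/
def Th (Φ : PP →ₗ[K] K) : PP →ₗ[K] PP × (PP ⧸ Wp Φ) :=
  (homogeneousComponent 2).prod (Wp Φ).mkQ

theorem Th_mul {Φ : PP →ₗ[K] K}
    (hΦ : ∀ m : Fin 4 →₀ ℕ, (m.sum fun _ e => e) ≠ 3 → Φ (monomial m 1) = 0)
    (hlin : ∀ u ∈ HH 1, u ∈ annIdeal K Φ → u = 0) (p : PP) :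
    ∀ {f : PP}, f ∈ annIdeal K Φ → ∃ c : K, Th Φ (p * f) = c • Th Φ f := by
  induction p using MvPolynomial.induction_on with
  | C a =>
    intro f hf
    exact ⟨a, by rw [← smul_eq_C_mul, map_smul]⟩
  | add p q hp hq =>
    intro f hf
    obtain ⟨c, hc⟩ := hp hf
    obtain ⟨d, hd⟩ := hq hf
    exact ⟨c + d, by rw [add_mul, map_add, hc, hd, add_smul]⟩
  | mul_X p i hp =>
    intro f hf
    refine ⟨0, ?_⟩
    have hg : p * f ∈ annIdeal K Φ := Ideal.mul_mem_left _ _ hf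
    have e : p * X i * f = X i * (p * f) := by ring
    rw [e, zero_smul]
    generalize p * f = g at hg
    have h2 : homogeneousComponent 2 (X i * g) = 0 := by
      rw [comp_X_mul, (comp_low hΦ hlin hg).2, mul_zero]
    have h3 : (Wp Φ).mkQ (X i * g) = 0 := by
      rw [Submodule.mkQ_apply, Submodule.Quotient.mk_eq_zero, Wp, Submodule.mem_comap, comp_X_mul]
      exact Submodule.subset_span ⟨i, _, ⟨comp_mem_H 2 g, comp_mem hΦ hg 2⟩, rfl⟩
    exact Prod.ext h2 h3

theorem lower {K : Type u} [Field K] {Φ : MvPolynomial (Fin 4) K →ₗ[K] K}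
    (hΦ : ∀ m : Fin 4 →₀ ℕ, (m.sum fun _ e => e) ≠ 3 → Φ (monomial m 1) = 0)
    (hlin : ∀ u ∈ homogeneousSubmodule (Fin 4) K 1, u ∈ annIdeal K Φ → u = 0)
    (hfd : FiniteDimensional K (MvPolynomial (Fin 4) K ⧸ Wp Φ)) (S : Set (MvPolynomial (Fin 4) K))
    (hS : Submodule.span (MvPolynomial (Fin 4) K) S = annIdeal K Φ) :
    ((6 + finrank K (J3 Φ) : ℕ) : Cardinal) ≤ Cardinal.mk S := by
  have h6 := finrank_I2 hΦ hlin
  have hfd2 : FiniteDimensional K (I2 Φ) := Module.finite_of_finrank_pos (by rw [h6]; norm_num)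
  let E : I2 Φ × J3 Φ →ₗ[K] MvPolynomial (Fin 4) K × (MvPolynomial (Fin 4) K ⧸ Wp Φ) :=
    (I2 Φ).subtype.prodMap (J3 Φ).subtype
  have hE : Function.Injective E := by
    rintro ⟨a, b⟩ ⟨a', b'⟩ h
    have h1 : a.1 = a'.1 := congrArg Prod.fst h
    have h2 : b.1 = b'.1 := congrArg Prod.snd h
    exact Prod.ext (Subtype.ext h1) (Subtype.ext h2)
  have hin : ∀ f ∈ annIdeal K Φ, Th Φ f ∈ Submodule.span K (Th Φ '' S) := by
    intro f hf
    rw [← hS] at hf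
    induction hf using Submodule.span_induction with
    | mem x hx => exact Submodule.subset_span ⟨x, hx, rfl⟩
    | zero => simp
    | add x y _ _ hx hy => rw [map_add]; exact add_mem hx hy
    | smul p x hx' hx =>
      rw [hS] at hx'
      obtain ⟨c, hc⟩ := Th_mul hΦ hlin p hx'
      rw [smul_eq_mul, hc]
      exact Submodule.smul_mem _ _ hx
  have hle : LinearMap.range E ≤ Submodule.span K (Th Φ '' S) := by
    rintro _ ⟨⟨⟨a, ha⟩, ⟨_, ⟨b, hb, rfl⟩⟩⟩, rfl⟩
    have e : E (⟨a, ha⟩, ⟨_, ⟨b, hb, rfl⟩⟩) = Th Φ a + Th Φ b := by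
      have ha3 : (Wp Φ).mkQ a = 0 := by
        rw [Submodule.mkQ_apply, Submodule.Quotient.mk_eq_zero, Wp, Submodule.mem_comap,
          homogeneousComponent_of_mem ha.1, if_neg (by norm_num)]
        exact zero_mem _
      have ha2 : homogeneousComponent 2 a = a := by
        rw [homogeneousComponent_of_mem ha.1, if_pos rfl]
      have hb2 : homogeneousComponent 2 b = 0 := by
        rw [homogeneousComponent_of_mem hb.1, if_neg (by norm_num)]
      refine Prod.ext ?_ ?_
      · change a = homogeneousComponent 2 a + homogeneousComponent 2 b
        rw [ha2, hb2, add_zero]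
      · change (Wp Φ).mkQ b = (Wp Φ).mkQ a + (Wp Φ).mkQ b
        rw [ha3, zero_add]
    rw [e]
    exact add_mem (hin a ha.2) (hin b hb.2)
  have h1 : Module.rank K (LinearMap.range E) = ((6 + finrank K (J3 Φ) : ℕ) : Cardinal) := by
    rw [rank_range_of_injective E hE, ← finrank_eq_rank, Module.finrank_prod, h6]
  rw [← h1]
  exact (Submodule.rank_mono hle).trans ((rank_span_le _).trans Cardinal.mk_image_le)

theorem upper {K : Type u} [Field K] {Φ : MvPolynomial (Fin 4) K →ₗ[K] K}
    (hΦ : ∀ m : Fin 4 →₀ ℕ, (m.sum fun _ e => e) ≠ 3 → Φ (monomial m 1) = 0)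
    (hlin : ∀ u ∈ homogeneousSubmodule (Fin 4) K 1, u ∈ annIdeal K Φ → u = 0)
    (hfd : FiniteDimensional K (MvPolynomial (Fin 4) K ⧸ Wp Φ)) :
    ∃ S : Set (MvPolynomial (Fin 4) K),
      Submodule.span (MvPolynomial (Fin 4) K) S = annIdeal K Φ ∧
      Cardinal.mk S ≤ ((6 + finrank K (J3 Φ) : ℕ) : Cardinal) := by
  have h6 := finrank_I2 hΦ hlin
  have hfd2 : FiniteDimensional K (I2 Φ) := Module.finite_of_finrank_pos (by rw [h6]; norm_num)
  let b := Module.finBasisOfFinrankEq K (I2 Φ) h6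
  let c := Module.finBasis K (J3 Φ)
  choose d hd hdc using fun i => (c i).2
  let s : Fin 6 ⊕ Fin (finrank K (J3 Φ)) → MvPolynomial (Fin 4) K :=
    Sum.elim (fun i => (b i).1) d
  refine ⟨Set.range s, ?_, ?_⟩
  swap
  · have := Cardinal.mk_range_le_lift (f := s)
    simpa using this
  apply le_antisymm
  · rw [Submodule.span_le]
    rintro _ ⟨i | i, rfl⟩
    · exact (b i).2.2
    · exact (hd i).2
  set J : Ideal (MvPolynomial (Fin 4) K) := Submodule.span (MvPolynomial (Fin 4) K) (Set.range s)
    with hJ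
  have hsJ : ∀ i, s i ∈ J := fun i => Submodule.subset_span ⟨i, rfl⟩
  have hsm : ∀ (r : K) {f : MvPolynomial (Fin 4) K}, f ∈ J → r • f ∈ J := by
    intro r f hf
    rw [smul_eq_C_mul]
    exact Ideal.mul_mem_left _ _ hf
  have hI2 : ∀ f ∈ I2 Φ, f ∈ J := by
    intro f hf
    have := b.sum_repr ⟨f, hf⟩
    have h2 := congrArg Subtype.val this
    simp only [Submodule.coe_sum, Submodule.coe_smul] at h2
    rw [← h2]
    exact sum_mem fun i _ => hsm _ (hsJ (Sum.inl i))
  have hW : ∀ f ∈ WW Φ, f ∈ J := by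
    have : WW Φ ≤ J.restrictScalars K := by
      rw [WW, Submodule.span_le]
      rintro _ ⟨i, g, hg, rfl⟩
      exact Ideal.mul_mem_left _ _ (hI2 g hg)
    exact this
  have hI3 : ∀ f ∈ I3 Φ, f ∈ J := by
    intro f hf
    have := c.sum_repr ⟨(Wp Φ).mkQ f, ⟨f, hf, rfl⟩⟩
    have h2 := congrArg Subtype.val this
    simp only [Submodule.coe_sum, Submodule.coe_smul] at h2
    set r := c.repr ⟨(Wp Φ).mkQ f, ⟨f, hf, rfl⟩⟩
    have h3 : f - ∑ i, r i • d i ∈ Wp Φ := by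
      rw [← Submodule.Quotient.mk_eq_zero, ← Submodule.mkQ_apply, map_sub, map_sum, ← h2,
        sub_eq_zero]
      refine Finset.sum_congr rfl fun i _ => ?_
      rw [map_smul, hdc]
    rw [mem_Wp_of_H (sub_mem hf.1 (sum_mem fun i _ => Submodule.smul_mem _ _ (hd i).1))] at h3
    have h4 : f = (f - ∑ i, r i • d i) + ∑ i, r i • d i := by abel
    rw [h4]
    exact add_mem (hW _ h3) (sum_mem fun i _ => hsm _ (hsJ (Sum.inr i)))
  obtain ⟨q, hq, hqd⟩ := exists_dual hΦ hlin
  have hX3 : ∀ (i : Fin 4) (g : MvPolynomial (Fin 4) K),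
      g ∈ homogeneousSubmodule (Fin 4) K 2 → X i * g ∈ homogeneousSubmodule (Fin 4) K 3 :=
    fun i g hg => IsHomogeneous.mul (isHomogeneous_X _ i) hg
  have h4 : homogeneousSubmodule (Fin 4) K 4 ≤ J.restrictScalars K := by
    apply H_le
    intro i g hg
    obtain ⟨j, hj⟩ := exists_ne i
    have e : X i * g = X i * (g - Φ g • (X j * q j)) + Φ g • (X j * (X i * q j)) := by
      rw [smul_eq_C_mul, smul_eq_C_mul]; ring
    rw [e]
    refine add_mem (Ideal.mul_mem_left _ _ (hI3 _ (mem_I3 hΦ ?_ ?_)))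
      (hsm _ (Ideal.mul_mem_left _ _ (hI3 _ (mem_I3 hΦ (hX3 _ _ (hq j)) ?_))))
    · exact sub_mem hg (Submodule.smul_mem _ _ (hX3 _ _ (hq j)))
    · rw [map_sub, map_smul, hqd]; simp
    · rw [hqd, if_neg hj.symm]
  have h4' : ∀ n, homogeneousSubmodule (Fin 4) K (n + 4) ≤ J.restrictScalars K := by
    intro n
    induction n with
    | zero => exact h4
    | succ n ih =>
      rw [show n + 1 + 4 = (n + 4) + 1 by ring]
      apply H_le
      intro i g hg
      exact Ideal.mul_mem_left _ _ (ih hg)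
  intro f hf
  rw [← sum_homogeneousComponent f]
  refine sum_mem fun n _ => ?_
  match n with
  | 0 => rw [(comp_low hΦ hlin hf).1]; exact zero_mem _
  | 1 => rw [(comp_low hΦ hlin hf).2]; exact zero_mem _
  | 2 => exact hI2 _ ⟨comp_mem_H 2 f, comp_mem hΦ hf 2⟩
  | 3 => exact hI3 _ ⟨comp_mem_H 3 f, comp_mem hΦ hf 3⟩
  | n + 4 => exact h4' n (comp_mem_H _ f)

theorem main {K : Type u} [Field K] {Φ : MvPolynomial (Fin 4) K →ₗ[K] K}
    (hΦ : ∀ m : Fin 4 →₀ ℕ, (m.sum fun _ e => e) ≠ 3 → Φ (monomial m 1) = 0)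
    (hlin : ∀ u ∈ homogeneousSubmodule (Fin 4) K 1, u ∈ annIdeal K Φ → u = 0) :
    (annIdeal K Φ : Submodule _ _).spanRankCard = 6 ∨
      (annIdeal K Φ : Submodule _ _).spanRankCard = 7 ∨
      (annIdeal K Φ : Submodule _ _).spanRankCard = 9 := by
  have hdim := cen_dim (tri_good hΦ hlin) (by simp)
  have hfd : FiniteDimensional K (MvPolynomial (Fin 4) K ⧸ Wp Φ) :=
    Module.finite_of_finrank_pos (by rw [finrank_T hΦ hlin]; omega)
  have hJ := finrank_J3 hΦ hlin hfd
  have heq : (annIdeal K Φ : Submodule _ _).spanRankCard = ((6 + finrank K (J3 Φ) : ℕ) : Cardinal) := by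
    obtain ⟨S, hS, hc⟩ := upper hΦ hlin hfd
    apply le_antisymm
    · exact (ciInf_le' _ (⟨S, hS⟩ : {s : Set (MvPolynomial (Fin 4) K) //
        Submodule.span (MvPolynomial (Fin 4) K) s = annIdeal K Φ})).trans hc
    · have : Nonempty {s : Set (MvPolynomial (Fin 4) K) //
        Submodule.span (MvPolynomial (Fin 4) K) s = annIdeal K Φ} := ⟨⟨S, hS⟩⟩
      exact le_ciInf fun s => lower hΦ hlin hfd s.1 s.2
  rw [heq]
  rcases hdim with h | h | h
  · left
    rw [show finrank K (J3 Φ) = 0 by omega]; norm_num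
  · right; left
    rw [show finrank K (J3 Φ) = 1 by omega]; norm_num
  · right; right
    rw [show finrank K (J3 Φ) = 3 by omega]; norm_num

end CubicCentre

/-- **Corollary 1.1.**  Let `k` be an arbitrary field, `P = k[x,y,z,w]`, and
`Φ : P → k` a `k`-linear functional vanishing on every monomial of total degree
different from `3` (a Macaulay inverse system of socle degree three).  If the
ideal `ann Φ` contains no nonzero linear form, then the minimal number of
generators of `ann Φ` is `6`, `7`, or `9`. -/
theorem annIdeal_spanRank_eq_six_or_seven_or_nine
    (Φ : MvPolynomial (Fin 4) k →ₗ[k] k)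
    (hΦ : ∀ m : Fin 4 →₀ ℕ, (m.sum fun _ e => e) ≠ 3 → Φ (monomial m 1) = 0)
    (hlin : ∀ u ∈ homogeneousSubmodule (Fin 4) k 1, u ∈ annIdeal k Φ → u = 0) :
    (annIdeal k Φ : Submodule _ _).spanRankCard = 6 ∨
      (annIdeal k Φ : Submodule _ _).spanRankCard = 7 ∨
      (annIdeal k Φ : Submodule _ _).spanRankCard = 9 := by
  exact CubicCentre.main hΦ hlin

end
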